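/- arXiv:2003.03969 — 2 statements merged into one kernel-verified Lean document; each statement's English description precedes it below -/
import Mathlib

section
/- Let M be a model category and g : X → Y a morphism in M. If g = β∘α and g = β′∘α′ are two minimal factorisations of g, with middle objects A and A′ respectively, then there exists an isomorphism φ : A → A′ such that φ∘α = α′ and β′∘φ = β. -/
open CategoryTheory CategoryTheory.Limits

universe v u

section ModelCat

variable {M : Type u} [Category.{v} M]

/-- `f` is a retract of `g`. -/
def IsRetractOf {X Y X' Y' : M} (f : X ⟶ Y) (g : X' ⟶ Y') : Prop :=
  ∃ (i : X ⟶ X') (r : X' ⟶ X) (j : Y ⟶ Y') (q : Y' ⟶ Y),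
    i ≫ r = 𝟙 X ∧ j ≫ q = 𝟙 Y ∧ i ≫ g = f ≫ j ∧ g ≫ q = r ≫ f

/-- The axioms MC2–MC5 of a model category (MC1, the existence of finite limits and
colimits, is recorded by the instances `HasFiniteLimits` and `HasFiniteColimits`). -/
structure ModelAxioms (M : Type u) [Category.{v} M]
    (weq fib cof : MorphismProperty M) : Prop where
  weq_comp : ∀ {X Y Z : M} (f : X ⟶ Y) (g : Y ⟶ Z), weq f → weq g → weq (f ≫ g)
  weq_cancel_left : ∀ {X Y Z : M} (f : X ⟶ Y) (g : Y ⟶ Z), weq f → weq (f ≫ g) → weq g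
  weq_cancel_right : ∀ {X Y Z : M} (f : X ⟶ Y) (g : Y ⟶ Z), weq g → weq (f ≫ g) → weq f
  weq_retract : ∀ {X Y X' Y' : M} (f : X ⟶ Y) (g : X' ⟶ Y'), IsRetractOf f g → weq g → weq f
  fib_retract : ∀ {X Y X' Y' : M} (f : X ⟶ Y) (g : X' ⟶ Y'), IsRetractOf f g → fib g → fib f
  cof_retract : ∀ {X Y X' Y' : M} (f : X ⟶ Y) (g : X' ⟶ Y'), IsRetractOf f g → cof g → cof f
  lifting_left : ∀ {A B E B' : M} (α : A ⟶ B) (β : E ⟶ B'), cof α → weq α → fib β →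
    HasLiftingProperty α β
  lifting_right : ∀ {A B E B' : M} (α : A ⟶ B) (β : E ⟶ B'), cof α → fib β → weq β →
    HasLiftingProperty α β
  fact_cof_trivFib : ∀ {X Y : M} (g : X ⟶ Y), ∃ (A : M) (α : X ⟶ A) (β : A ⟶ Y),
    cof α ∧ fib β ∧ weq β ∧ α ≫ β = g
  fact_trivCof_fib : ∀ {X Y : M} (g : X ⟶ Y), ∃ (A : M) (α : X ⟶ A) (β : A ⟶ Y),
    cof α ∧ weq α ∧ fib β ∧ α ≫ β = g

/-- A factorisation `g = β ∘ α` with `α` a cofibration and `β` a trivial fibration is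
minimal if every endomorphism `φ` of the middle object compatible with the factorisation
is an isomorphism. -/
def IsMinimalFactorisation (weq fib cof : MorphismProperty M) {X Y A : M}
    (g : X ⟶ Y) (α : X ⟶ A) (β : A ⟶ Y) : Prop :=
  α ≫ β = g ∧ cof α ∧ fib β ∧ weq β ∧
    ∀ φ : A ⟶ A, α ≫ φ = α → φ ≫ β = β → IsIso φ

end ModelCat

/-- A cofibration followed by any morphism maps compatibly to any other factorisation of
the composite whose second morphism is a trivial fibration. -/
theorem exists_lift_of_cof_of_trivFib {M : Type u} [Category.{v} M]
    {weq fib cof : MorphismProperty M} (hM : ModelAxioms M weq fib cof)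
    {X Y A A' : M} {α : X ⟶ A} {β : A ⟶ Y} {α' : X ⟶ A'} {β' : A' ⟶ Y}
    (hα : cof α) (hβ' : fib β') (hβw' : weq β') (w : α ≫ β = α' ≫ β') :
    ∃ φ : A ⟶ A', α ≫ φ = α' ∧ φ ≫ β' = β := by
  have := hM.lifting_right α β' hα hβ' hβw'
  have sq : CommSq α' α β' β := ⟨w.symm⟩
  exact ⟨sq.lift, sq.fac_left, sq.fac_right⟩

/-- In a model category, any two minimal factorisations of a morphism
`g : X ⟶ Y` are connected by an isomorphism `φ` of the middle objects compatible with
the factorisations. -/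
theorem stmt_0 {M : Type u} [Category.{v} M] [HasFiniteLimits M] [HasFiniteColimits M]
    (weq fib cof : MorphismProperty M) (hM : ModelAxioms M weq fib cof)
    {X Y A A' : M} (g : X ⟶ Y) (α : X ⟶ A) (β : A ⟶ Y) (α' : X ⟶ A') (β' : A' ⟶ Y)
    (h : IsMinimalFactorisation weq fib cof g α β)
    (h' : IsMinimalFactorisation weq fib cof g α' β') :
    ∃ φ : A ⟶ A', IsIso φ ∧ α ≫ φ = α' ∧ φ ≫ β' = β := by
  obtain ⟨hg, hα, hβ, hβw, hmin⟩ := h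
  obtain ⟨hg', hα', hβ', hβw', hmin'⟩ := h'
  obtain ⟨φ, hφα, hφβ⟩ := exists_lift_of_cof_of_trivFib hM hα hβ' hβw' (hg.trans hg'.symm)
  obtain ⟨ψ, hψα, hψβ⟩ := exists_lift_of_cof_of_trivFib hM hα' hβ hβw (hg'.trans hg.symm)
  have hφψ : IsIso (φ ≫ ψ) := hmin _ (by rw [reassoc_of% hφα, hψα])
    (by rw [Category.assoc, hψβ, hφβ])
  have hψφ : IsIso (ψ ≫ φ) := hmin' _ (by rw [reassoc_of% hψα, hφα])
    (by rw [Category.assoc, hφβ, hψβ])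
  have : Mono φ := mono_of_mono φ ψ
  have : IsSplitEpi φ := ⟨⟨⟨inv (ψ ≫ φ) ≫ ψ, by simp only [Category.assoc, IsIso.inv_hom_id]⟩⟩⟩
  exact ⟨φ, isIso_of_mono_of_isSplitEpi φ, hφα, hφβ⟩
end

section
/- Let M be a model category, and let X′ and Y′ be minimal representatives of objects X and Y respectively. Then X and Y are weakly equivalent if and only if X′ and Y′ are isomorphic. -/
open CategoryTheory CategoryTheory.Limits

universe v u

section Minimal

variable {M : Type u} [Category.{v} M]

/-- Two objects are weakly equivalent if they are connected by a finite zigzag of weak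
equivalences. -/
def WeaklyEquivalent (weq : MorphismProperty M) : M → M → Prop :=
  Relation.ReflTransGen (fun X Y => (∃ f : X ⟶ Y, weq f) ∨ (∃ f : Y ⟶ X, weq f))

variable [HasFiniteLimits M] [HasFiniteColimits M]

/-- An object is cofibrant if the morphism from the initial object is a cofibration. -/
def Cofibrant (cof : MorphismProperty M) (X : M) : Prop := cof (initial.to X)

/-- An object is fibrant if the morphism to the terminal object is a fibration. -/
def Fibrant (fib : MorphismProperty M) (X : M) : Prop := fib (terminal.from X)

/-- An object is minimal if it is cofibrant, fibrant, and every self weak equivalence of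
it is an isomorphism. -/
def MinimalObject (weq fib cof : MorphismProperty M) (X : M) : Prop :=
  Cofibrant cof X ∧ Fibrant fib X ∧ ∀ φ : X ⟶ X, weq φ → IsIso φ

/-- A minimal representative of `X` is a minimal object weakly equivalent to `X`. -/
def MinimalRepresentative (weq fib cof : MorphismProperty M) (X' X : M) : Prop :=
  MinimalObject weq fib cof X' ∧ WeaklyEquivalent weq X' X

end Minimal

section ModelLemmas

variable {M : Type u} [Category.{v} M] {weq fib cof : MorphismProperty M}

theorem WeaklyEquivalent.symm {X Y : M} (h : WeaklyEquivalent weq X Y) :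
    WeaklyEquivalent weq Y X :=
  have : Std.Symm (fun X Y : M => (∃ f : X ⟶ Y, weq f) ∨ (∃ f : Y ⟶ X, weq f)) :=
    ⟨fun _ _ h => h.symm⟩
  Relation.ReflTransGen.stdSymm.symm _ _ h

theorem ModelAxioms.weq_id (hM : ModelAxioms M weq fib cof) (X : M) : weq (𝟙 X) := by
  obtain ⟨A, α, β, -, hα, -, -⟩ := hM.fact_trivCof_fib (𝟙 X)
  exact hM.weq_cancel_right (𝟙 X) α hα (by simpa using hα)

theorem ModelAxioms.weq_of_iso (hM : ModelAxioms M weq fib cof) {X Y : M} (e : X ≅ Y) :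
    weq e.hom :=
  hM.weq_retract e.hom (𝟙 X) ⟨𝟙 X, 𝟙 X, e.inv, e.hom, by simp⟩ (hM.weq_id X)

/-- A span of weak equivalences whose second leg has fibrant target can be replaced by one
whose first leg is moreover a fibration. -/
theorem ModelAxioms.exists_trivFib_span [HasFiniteLimits M]
    (hM : ModelAxioms M weq fib cof) {C Z P : M}
    (hP : Fibrant fib P) (f : C ⟶ Z) (g : C ⟶ P) (hf : weq f) (hg : weq g) :
    ∃ (D : M) (p : D ⟶ Z) (q : D ⟶ P), fib p ∧ weq p ∧ weq q := by
  obtain ⟨D, α, p, hαc, hαw, hp, rfl⟩ := hM.fact_trivCof_fib f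
  have := hM.lifting_left α _ hαc hαw hP
  have sq : CommSq g α (terminal.from P) (terminal.from D) := ⟨Subsingleton.elim _ _⟩
  refine ⟨D, p, sq.lift, hp, hM.weq_cancel_left α p hαw hf, ?_⟩
  exact hM.weq_cancel_left α _ hαw (by simpa using hg)

theorem ModelAxioms.exists_lift_of_cofibrant [HasFiniteColimits M]
    (hM : ModelAxioms M weq fib cof) {C D Z : M}
    (hC : Cofibrant cof C) (p : D ⟶ Z) (hp : fib p) (hpw : weq p) (f : C ⟶ Z) :
    ∃ l : C ⟶ D, l ≫ p = f := by
  have := hM.lifting_right _ p hC hp hpw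
  have sq : CommSq (initial.to D) (initial.to C) p f := ⟨Subsingleton.elim _ _⟩
  exact ⟨sq.lift, sq.fac_right⟩

variable [HasFiniteLimits M] [HasFiniteColimits M]

theorem ModelAxioms.exists_span_of_weaklyEquivalent (hM : ModelAxioms M weq fib cof) {P Z : M}
    (hP : Fibrant fib P) (h : WeaklyEquivalent weq P Z) :
    ∃ (C : M) (f : C ⟶ Z) (g : C ⟶ P), weq f ∧ weq g := by
  induction h with
  | refl => exact ⟨P, 𝟙 P, 𝟙 P, hM.weq_id P, hM.weq_id P⟩
  | @tail Z W _ hs ih =>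
    obtain ⟨C, f, g, hf, hg⟩ := ih
    obtain ⟨s, hs⟩ | ⟨s, hs⟩ := hs
    · exact ⟨C, f ≫ s, g, hM.weq_comp f s hf hs, hg⟩
    · obtain ⟨D, p, q, hp, hpw, hq⟩ := hM.exists_trivFib_span hP f g hf hg
      obtain ⟨C', α, β, hα, -, hβ, -⟩ := hM.fact_cof_trivFib (initial.to W)
      have hC' : Cofibrant cof C' := by
        rwa [Cofibrant, Subsingleton.elim (initial.to C') α]
      obtain ⟨l, hl⟩ := hM.exists_lift_of_cofibrant hC' p hp hpw (β ≫ s)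
      have hlw : weq l := hM.weq_cancel_right l p hpw (hl ▸ hM.weq_comp β s hβ hs)
      exact ⟨C', β, l ≫ q, hβ, hM.weq_comp l q hlw hq⟩

theorem ModelAxioms.exists_weq_of_span (hM : ModelAxioms M weq fib cof) {C P Q : M}
    (hP : Cofibrant cof P) (hQ : Fibrant fib Q) (f : C ⟶ P) (g : C ⟶ Q)
    (hf : weq f) (hg : weq g) : ∃ φ : P ⟶ Q, weq φ := by
  obtain ⟨D, p, q, hp, hpw, hq⟩ := hM.exists_trivFib_span hQ f g hf hg
  obtain ⟨l, hl⟩ := hM.exists_lift_of_cofibrant hP p hp hpw (𝟙 P)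
  exact ⟨l ≫ q, hM.weq_comp l q (hM.weq_cancel_right l p hpw (hl ▸ hM.weq_id P)) hq⟩

theorem ModelAxioms.nonempty_iso_of_minimalObject (hM : ModelAxioms M weq fib cof) {P Q : M}
    (hP : MinimalObject weq fib cof P) (hQ : MinimalObject weq fib cof Q)
    (h : WeaklyEquivalent weq P Q) : Nonempty (P ≅ Q) := by
  obtain ⟨hPc, hPf, hPm⟩ := hP
  obtain ⟨hQc, hQf, hQm⟩ := hQ
  obtain ⟨C, g, f, hg, hf⟩ := hM.exists_span_of_weaklyEquivalent hPf h
  obtain ⟨φ, hφ⟩ := hM.exists_weq_of_span hPc hQf f g hf hg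
  obtain ⟨ψ, hψ⟩ := hM.exists_weq_of_span hQc hPf g f hg hf
  have := hPm (φ ≫ ψ) (hM.weq_comp φ ψ hφ hψ)
  have := hQm (ψ ≫ φ) (hM.weq_comp ψ φ hψ hφ)
  have : IsSplitMono φ := ⟨⟨ψ ≫ inv (φ ≫ ψ), by rw [← Category.assoc, IsIso.hom_inv_id]⟩⟩
  have : Epi φ := epi_of_epi ψ φ
  have : IsIso φ := isIso_of_epi_of_isSplitMono φ
  exact ⟨asIso φ⟩

end ModelLemmas

/-- If `X'` and `Y'` are minimal representatives of `X` and `Y`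
respectively, then `X` and `Y` are weakly equivalent if and only if `X'` and `Y'` are
isomorphic. -/
theorem stmt_1 {M : Type u} [Category.{v} M] [HasFiniteLimits M] [HasFiniteColimits M]
    (weq fib cof : MorphismProperty M) (hM : ModelAxioms M weq fib cof)
    {X Y X' Y' : M}
    (hX : MinimalRepresentative weq fib cof X' X)
    (hY : MinimalRepresentative weq fib cof Y' Y) :
    WeaklyEquivalent weq X Y ↔ Nonempty (X' ≅ Y') := by
  constructor
  · intro h
    exact hM.nonempty_iso_of_minimalObject hX.1 hY.1 ((hX.2.trans h).trans hY.2.symm)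
  · rintro ⟨e⟩
    exact (hX.2.symm.tail (Or.inl ⟨e.hom, hM.weq_of_iso e⟩)).trans hY.2
end
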